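/- (Central limit theorem for the CLS score.) Let (X_t)_{t≥0} be the canonical stationary BAR(1) chain with parameters (ρ, p), and set s_t = X_t − ρ X_{t−1} − N p(1−ρ). Then the law of the random vector n^{−1/2}·( Σ_{t=1}^n s_t (X_{t−1} − Np), N(1−ρ) Σ_{t=1}^n s_t ) converges weakly, as n → ∞, to the centered two-dimensional Gaussian distribution with covariance matrix W_CLS. -/

import Mathlib

open MeasureTheory Filter Finset Matrix

noncomputable section

/-- BAR(1) one-step transition probability `K(i,{j})` with parameters `(ρ, p)`,
where `β = p(1-ρ)` and `α = β + ρ`. -/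
def barK (N : ℕ) (ρ p : ℝ) (i j : ℕ) : ℝ :=
  ∑ k ∈ Finset.Icc (i + j - N) (min i j),
    (Nat.choose i k : ℝ) * (Nat.choose (N - i) (j - k)) *
      (p * (1 - ρ) + ρ) ^ k * (1 - (p * (1 - ρ) + ρ)) ^ (i - k) *
      (p * (1 - ρ)) ^ (j - k) * (1 - p * (1 - ρ)) ^ (N + k - (i + j))

/-- Binomial(N,p) probability mass function. -/
def binomPMF (N : ℕ) (p : ℝ) (i : ℕ) : ℝ :=
  (Nat.choose N i : ℝ) * p ^ i * (1 - p) ^ (N - i)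

/-- CLS estimator of ρ from observations `x 0, …, x n`. -/
def clsRho (x : ℕ → ℝ) (n : ℕ) : ℝ :=
  ((n : ℝ) * ∑ t ∈ Finset.Icc 1 n, x t * x (t - 1)
      - (∑ t ∈ Finset.Icc 1 n, x t) * (∑ t ∈ Finset.Icc 1 n, x (t - 1))) /
    ((n : ℝ) * ∑ t ∈ Finset.Icc 1 n, (x (t - 1)) ^ 2
      - (∑ t ∈ Finset.Icc 1 n, x (t - 1)) ^ 2)

/-- CLS estimator of p from observations `x 0, …, x n`. -/
def clsP (N : ℕ) (x : ℕ → ℝ) (n : ℕ) : ℝ :=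
  ((∑ t ∈ Finset.Icc 1 n, x t) - clsRho x n * ∑ t ∈ Finset.Icc 1 n, x (t - 1)) /
    ((n : ℝ) * N * (1 - clsRho x n))

/-- The real-valued observation sequence attached to a trajectory `ω`. -/
def xR (ω : ℕ → ℕ) (t : ℕ) : ℝ := (ω t : ℝ)

/-- Conditional variance σ²(i) of the BAR(1) model. -/
def sigmaSq (N : ℕ) (ρ p : ℝ) (i : ℕ) : ℝ :=
  ρ * (1 - ρ) * (1 - 2 * p) * i + N * p * (1 - ρ) * (1 - p * (1 - ρ))

/-- The matrix `W_CLS`. -/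
def Wcls (N : ℕ) (ρ p : ℝ) : Matrix (Fin 2) (Fin 2) ℝ :=
  !![∑ i ∈ Finset.range (N + 1), binomPMF N p i * ((i : ℝ) - N * p) ^ 2 * sigmaSq N ρ p i,
     (N : ℝ) * (1 - ρ) *
       ∑ i ∈ Finset.range (N + 1), binomPMF N p i * ((i : ℝ) - N * p) * sigmaSq N ρ p i;
     (N : ℝ) * (1 - ρ) *
       ∑ i ∈ Finset.range (N + 1), binomPMF N p i * ((i : ℝ) - N * p) * sigmaSq N ρ p i,
     (N : ℝ) ^ 2 * (1 - ρ) ^ 2 * ∑ i ∈ Finset.range (N + 1), binomPMF N p i * sigmaSq N ρ p i]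


/-- Tilted transition operator on functions on `{0,…,N}`. -/
def tiltOp (N : ℕ) (K : ℕ → ℕ → ℝ) (e : ℕ → ℕ → ℂ) (h : ℕ → ℂ) : ℕ → ℂ :=
  fun i => ∑ j ∈ Finset.range (N + 1), (K i j : ℂ) * e i j * h j

lemma tiltOp_contr {N : ℕ} {K : ℕ → ℕ → ℝ} {e : ℕ → ℕ → ℂ}
    (hK : ∀ i j, 0 ≤ K i j) (hK1 : ∀ i ∈ range (N+1), ∑ j ∈ range (N+1), K i j = 1)
    (he : ∀ i j, ‖e i j‖ ≤ 1) {h : ℕ → ℂ} {B : ℝ} (hh : ∀ i ∈ range (N+1), ‖h i‖ ≤ B) :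
    ∀ i ∈ range (N+1), ‖tiltOp N K e h i‖ ≤ B := by
  intro i hi
  calc ‖tiltOp N K e h i‖ ≤ ∑ j ∈ range (N+1), ‖(K i j : ℂ) * e i j * h j‖ := norm_sum_le _ _
    _ ≤ ∑ j ∈ range (N+1), K i j * B := by
        apply Finset.sum_le_sum
        intro j hj
        rw [norm_mul, norm_mul, Complex.norm_real, Real.norm_of_nonneg (hK i j), mul_assoc]
        apply mul_le_mul_of_nonneg_left _ (hK i j)
        calc ‖e i j‖ * ‖h j‖ ≤ 1 * ‖h j‖ := by gcongr; exact he i j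
          _ ≤ B := by rw [one_mul]; exact hh j hj
    _ = B := by rw [← Finset.sum_mul, hK1 i hi, one_mul]

lemma tiltOp_sub {N : ℕ} {K : ℕ → ℕ → ℝ} {e : ℕ → ℕ → ℂ} (f g : ℕ → ℂ) (i : ℕ) :
    tiltOp N K e (fun j => f j - g j) i = tiltOp N K e f i - tiltOp N K e g i := by
  simp only [tiltOp, mul_sub, Finset.sum_sub_distrib]

lemma tiltOp_smul {N : ℕ} {K : ℕ → ℕ → ℝ} {e : ℕ → ℕ → ℂ} (c : ℂ) (g : ℕ → ℂ) (i : ℕ) :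
    tiltOp N K e (fun j => c * g j) i = c * tiltOp N K e g i := by
  simp only [tiltOp, Finset.mul_sum]
  exact Finset.sum_congr rfl fun j _ => by ring

lemma tiltOp_iter_approx {N : ℕ} {K : ℕ → ℕ → ℝ} {e : ℕ → ℕ → ℂ}
    (hK : ∀ i j, 0 ≤ K i j) (hK1 : ∀ i ∈ range (N+1), ∑ j ∈ range (N+1), K i j = 1)
    (he : ∀ i j, ‖e i j‖ ≤ 1) {h : ℕ → ℂ} {l : ℂ} {B : ℝ} (hl : ‖l‖ ≤ 1)
    (hh : ∀ i ∈ range (N+1), ‖tiltOp N K e h i - l * h i‖ ≤ B) (m : ℕ) :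
    ∀ i ∈ range (N+1), ‖(tiltOp N K e)^[m] h i - l ^ m * h i‖ ≤ m * B := by
  induction m with
  | zero => intro i _; simp
  | succ m ih =>
    intro i hi
    rw [Function.iterate_succ_apply']
    have h1 := tiltOp_contr hK hK1 he ih i hi
    rw [tiltOp_sub, tiltOp_smul] at h1
    have h2 : ‖l ^ m * (tiltOp N K e h i - l * h i)‖ ≤ B := by
      rw [norm_mul, norm_pow]
      have : ‖l‖ ^ m ≤ 1 := pow_le_one₀ (norm_nonneg _) hl
      calc _ ≤ 1 * ‖tiltOp N K e h i - l * h i‖ := by gcongr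
        _ ≤ B := by rw [one_mul]; exact hh i hi
    calc _ = ‖(tiltOp N K e ((tiltOp N K e)^[m] h) i - l ^ m * tiltOp N K e h i)
          + l ^ m * (tiltOp N K e h i - l * h i)‖ := by congr 1; ring
      _ ≤ m * B + B := (norm_add_le _ _).trans (add_le_add h1 h2)
      _ = _ := by push_cast; ring

lemma tiltOp_iter_diff {N : ℕ} {K : ℕ → ℕ → ℝ} {e : ℕ → ℕ → ℂ}
    (hK : ∀ i j, 0 ≤ K i j) (hK1 : ∀ i ∈ range (N+1), ∑ j ∈ range (N+1), K i j = 1)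
    (he : ∀ i j, ‖e i j‖ ≤ 1) {f h : ℕ → ℂ} {B : ℝ}
    (hh : ∀ i ∈ range (N+1), ‖f i - h i‖ ≤ B) (m : ℕ) :
    ∀ i ∈ range (N+1), ‖(tiltOp N K e)^[m] f i - (tiltOp N K e)^[m] h i‖ ≤ B := by
  induction m with
  | zero => simpa using hh
  | succ m ih =>
    intro i hi
    rw [Function.iterate_succ_apply', Function.iterate_succ_apply', ← tiltOp_sub]
    exact tiltOp_contr hK hK1 he ih i hi

lemma exp_taylor3 {D ε d : ℝ} (hε0 : 0 ≤ ε) (hε : ε ≤ 1) (hd : |d| ≤ D) :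
    ‖Complex.exp (Complex.I * ((ε * d : ℝ) : ℂ)) -
      (1 + Complex.I * ((ε * d : ℝ) : ℂ) - ((ε ^ 2 * d ^ 2 / 2 : ℝ) : ℂ))‖
      ≤ ε ^ 3 * (D ^ 3 * Real.exp D) ∧
    ‖Complex.exp (Complex.I * ((ε * d : ℝ) : ℂ)) - 1‖ ≤ ε * (D * Real.exp D) := by
  have hD : 0 ≤ D := (abs_nonneg _).trans hd
  have hn : ‖Complex.I * ((ε * d : ℝ) : ℂ)‖ = ε * |d| := by
    rw [norm_mul, Complex.norm_I, Complex.norm_real, one_mul, Real.norm_eq_abs, abs_mul,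
      abs_of_nonneg hε0]
  have hle : ε * |d| ≤ ε * D := by gcongr
  have hle2 : ε * |d| ≤ D := hle.trans (mul_le_of_le_one_left hD hε)
  constructor
  · have := Complex.norm_exp_sub_sum_le_norm_mul_exp (Complex.I * ((ε * d : ℝ) : ℂ)) 3
    rw [hn] at this
    calc _ = ‖Complex.exp (Complex.I * ((ε * d : ℝ) : ℂ)) - ∑ m ∈ range 3, (Complex.I * ((ε * d : ℝ) : ℂ)) ^ m / m.factorial‖ := by
          congr 2
          simp [Finset.sum_range_succ, mul_pow, Nat.factorial]
          ring
      _ ≤ _ := this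
      _ ≤ (ε * D) ^ 3 * Real.exp D := by gcongr
      _ = _ := by ring
  · have := Complex.norm_exp_sub_sum_le_norm_mul_exp (Complex.I * ((ε * d : ℝ) : ℂ)) 1
    rw [hn] at this
    calc _ = ‖Complex.exp (Complex.I * ((ε * d : ℝ) : ℂ)) - ∑ m ∈ range 1, (Complex.I * ((ε * d : ℝ) : ℂ)) ^ m / m.factorial‖ := by
          simp
      _ ≤ _ := this
      _ ≤ (ε * D) ^ 1 * Real.exp D := by gcongr
      _ = _ := by ring

lemma one_step {N : ℕ} {K d : ℕ → ℕ → ℝ} {v g : ℕ → ℝ} {c D Gb ε : ℝ}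
    (hK : ∀ i j, 0 ≤ K i j) (hK1 : ∀ i ∈ range (N+1), ∑ j ∈ range (N+1), K i j = 1)
    (hm : ∀ i ∈ range (N+1), ∑ j ∈ range (N+1), K i j * d i j = 0)
    (hv : ∀ i ∈ range (N+1), ∑ j ∈ range (N+1), K i j * d i j ^ 2 = v i)
    (hg : ∀ i ∈ range (N+1), g i - ∑ j ∈ range (N+1), K i j * g j = - (v i - c) / 2)
    (hc : 0 ≤ c) (hD : ∀ i ∈ range (N+1), ∀ j ∈ range (N+1), |d i j| ≤ D)
    (hG : ∀ i ∈ range (N+1), |g i| ≤ Gb) (hε0 : 0 ≤ ε) (hε : ε ≤ 1) :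
    ∀ i ∈ range (N+1),
      ‖tiltOp N K (fun i j => Complex.exp (Complex.I * ((ε * d i j : ℝ) : ℂ)))
          (fun j => 1 + ((ε ^ 2 * g j : ℝ) : ℂ)) i
        - ((1 - ε ^ 2 * c / 2 : ℝ) : ℂ) * (1 + ((ε ^ 2 * g i : ℝ) : ℂ))‖
      ≤ ε ^ 3 * (D ^ 3 * Real.exp D + D * Real.exp D * Gb + c * Gb / 2) := by
  intro i hi
  have hD0 : 0 ≤ D := (abs_nonneg _).trans (hD i hi i hi)
  have hG0 : 0 ≤ Gb := (abs_nonneg _).trans (hG i hi)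
  have hmain : ∑ j ∈ range (N+1), (K i j : ℂ) * (1 + Complex.I * ((ε * d i j : ℝ) : ℂ)
      - ((ε ^ 2 * d i j ^ 2 / 2 : ℝ) : ℂ) + ((ε ^ 2 * g j : ℝ) : ℂ))
      = 1 + ((ε ^ 2 * g i - ε ^ 2 * c / 2 : ℝ) : ℂ) := by
    have e1 : ∀ j, (K i j : ℂ) * (1 + Complex.I * ((ε * d i j : ℝ) : ℂ)
      - ((ε ^ 2 * d i j ^ 2 / 2 : ℝ) : ℂ) + ((ε ^ 2 * g j : ℝ) : ℂ))
      = ((K i j : ℝ) : ℂ) + Complex.I * ε * ((K i j * d i j : ℝ) : ℂ)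
        - (ε ^ 2 / 2) * ((K i j * d i j ^ 2 : ℝ) : ℂ) + ε ^ 2 * ((K i j * g j : ℝ) : ℂ) := by
      intro j; push_cast; ring
    simp only [e1, Finset.sum_add_distrib, Finset.sum_sub_distrib, ← Finset.mul_sum]
    rw [← Complex.ofReal_sum, ← Complex.ofReal_sum, ← Complex.ofReal_sum, ← Complex.ofReal_sum,
      hK1 i hi, hm i hi, hv i hi]
    have : ∑ j ∈ range (N+1), K i j * g j = g i + (v i - c) / 2 := by linarith [hg i hi]
    rw [this]; push_cast; ring
  have hdec : tiltOp N K (fun i j => Complex.exp (Complex.I * ((ε * d i j : ℝ) : ℂ)))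
          (fun j => 1 + ((ε ^ 2 * g j : ℝ) : ℂ)) i
        - ((1 - ε ^ 2 * c / 2 : ℝ) : ℂ) * (1 + ((ε ^ 2 * g i : ℝ) : ℂ))
      = ∑ j ∈ range (N+1), (K i j : ℂ) *
          ((Complex.exp (Complex.I * ((ε * d i j : ℝ) : ℂ)) -
      (1 + Complex.I * ((ε * d i j : ℝ) : ℂ) - ((ε ^ 2 * d i j ^ 2 / 2 : ℝ) : ℂ)))
          + (Complex.exp (Complex.I * ((ε * d i j : ℝ) : ℂ)) - 1) * ((ε ^ 2 * g j : ℝ) : ℂ))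
        + ((ε ^ 4 * c * g i / 2 : ℝ) : ℂ) := by
    have : (1 : ℂ) * (1 + ((ε ^ 2 * g i - ε ^ 2 * c / 2 : ℝ) : ℂ)) =
       ((1 - ε ^ 2 * c / 2 : ℝ) : ℂ) * (1 + ((ε ^ 2 * g i : ℝ) : ℂ)) + ((ε ^ 4 * c * g i / 2 : ℝ) : ℂ) := by
      push_cast; ring
    rw [one_mul, ← hmain] at this
    rw [eq_sub_of_add_eq this.symm, sub_sub_eq_add_sub, add_sub_right_comm, tiltOp, ← Finset.sum_sub_distrib]
    congr 1
    exact Finset.sum_congr rfl fun j _ => by ring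
  rw [hdec]
  have hb : ∀ j ∈ range (N+1), ‖(K i j : ℂ) *
          ((Complex.exp (Complex.I * ((ε * d i j : ℝ) : ℂ)) -
      (1 + Complex.I * ((ε * d i j : ℝ) : ℂ) - ((ε ^ 2 * d i j ^ 2 / 2 : ℝ) : ℂ)))
          + (Complex.exp (Complex.I * ((ε * d i j : ℝ) : ℂ)) - 1) * ((ε ^ 2 * g j : ℝ) : ℂ))‖
      ≤ K i j * (ε ^ 3 * (D ^ 3 * Real.exp D + D * Real.exp D * Gb)) := by
    intro j hj
    obtain ⟨t1, t2⟩ := exp_taylor3 hε0 hε (hD i hi j hj)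
    rw [norm_mul, Complex.norm_real, Real.norm_of_nonneg (hK i j)]
    apply mul_le_mul_of_nonneg_left _ (hK i j)
    have t3 : ‖((ε ^ 2 * g j : ℝ) : ℂ)‖ ≤ ε ^ 2 * Gb := by
      rw [Complex.norm_real, Real.norm_eq_abs, abs_mul, abs_of_nonneg (by positivity)]
      gcongr; exact hG j hj
    calc _ ≤ _ := norm_add_le _ _
      _ ≤ ε ^ 3 * (D ^ 3 * Real.exp D) + (ε * (D * Real.exp D)) * (ε ^ 2 * Gb) := by
          rw [norm_mul]; gcongr
      _ = _ := by ring
  have hlast : ‖((ε ^ 4 * c * g i / 2 : ℝ) : ℂ)‖ ≤ ε ^ 3 * (c * Gb / 2) := by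
    rw [Complex.norm_real, Real.norm_eq_abs, abs_div, abs_mul, abs_of_nonneg (a := ε ^ 4 * c) (by positivity), abs_two]
    have : ε ^ 4 ≤ ε ^ 3 := pow_le_pow_of_le_one hε0 hε (by norm_num)
    calc _ ≤ ε ^ 3 * c * Gb / 2 := by gcongr; exact hG i hi
      _ = _ := by ring
  calc _ ≤ _ := norm_add_le _ _
    _ ≤ ∑ j ∈ range (N+1), K i j * (ε ^ 3 * (D ^ 3 * Real.exp D + D * Real.exp D * Gb)) + ε ^ 3 * (c * Gb / 2) :=
        add_le_add ((norm_sum_le _ _).trans (Finset.sum_le_sum hb)) hlast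
    _ = _ := by rw [← Finset.sum_mul, hK1 i hi]; ring

lemma tilt_limit {N : ℕ} {K d : ℕ → ℕ → ℝ} {v g : ℕ → ℝ} {c : ℝ}
    (hK : ∀ i j, 0 ≤ K i j) (hK1 : ∀ i ∈ range (N+1), ∑ j ∈ range (N+1), K i j = 1)
    (hm : ∀ i ∈ range (N+1), ∑ j ∈ range (N+1), K i j * d i j = 0)
    (hv : ∀ i ∈ range (N+1), ∑ j ∈ range (N+1), K i j * d i j ^ 2 = v i)
    (hg : ∀ i ∈ range (N+1), g i - ∑ j ∈ range (N+1), K i j * g j = - (v i - c) / 2)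
    (hc : 0 ≤ c) :
    ∀ i ∈ range (N+1), Tendsto (fun n : ℕ =>
      (tiltOp N K (fun i j => Complex.exp (Complex.I * ((1 / Real.sqrt n * d i j : ℝ) : ℂ))))^[n]
        (fun _ => 1) i) atTop (nhds (Complex.exp ((-c / 2 : ℝ) : ℂ))) := by
  intro i hi
  obtain ⟨D, hD⟩ : ∃ D, ∀ i ∈ range (N+1), ∀ j ∈ range (N+1), |d i j| ≤ D :=
    ⟨∑ a ∈ range (N+1), ∑ b ∈ range (N+1), |d a b|, fun a ha b hb =>
      (Finset.single_le_sum (f := fun b => |d a b|) (fun _ _ => abs_nonneg _) hb).trans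
      (Finset.single_le_sum (f := fun a => ∑ b ∈ range (N+1), |d a b|)
        (fun _ _ => Finset.sum_nonneg fun _ _ => abs_nonneg _) ha)⟩
  obtain ⟨Gb, hG⟩ : ∃ D, ∀ i ∈ range (N+1), |g i| ≤ D :=
    ⟨∑ b ∈ range (N+1), |g b|, fun b hb =>
      (Finset.single_le_sum (f := fun b => |g b|) (fun _ _ => abs_nonneg _) hb)⟩
  have hl : Tendsto (fun n : ℕ => (1 + ((-c / 2 : ℝ) : ℂ) / n) ^ n) atTop
    (nhds (Complex.exp ((-c / 2 : ℝ) : ℂ))) := Complex.tendsto_one_add_div_pow_exp _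
  set C := D ^ 3 * Real.exp D + D * Real.exp D * Gb + c * Gb / 2 with hC
  have hs : Tendsto (fun n : ℕ => 1 / Real.sqrt n) atTop (nhds 0) := by
    simp only [one_div]
    exact tendsto_inv_atTop_zero.comp (Real.tendsto_sqrt_atTop.comp tendsto_natCast_atTop_atTop)
  have hb : Tendsto (fun n : ℕ => 2 * (1 / Real.sqrt n) ^ 2 * Gb + C * (1 / Real.sqrt n)) atTop (nhds 0) := by
    have := (((hs.pow 2).const_mul 2).mul_const Gb).add (hs.const_mul C)
    simpa using this
  refine hl.congr_dist ?_
  refine squeeze_zero' (Eventually.of_forall fun _ => dist_nonneg) ?_ hb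
  filter_upwards [eventually_ge_atTop 1, eventually_ge_atTop (Nat.ceil c)] with n hn1 hnc
  have hn : (1:ℝ) ≤ n := by exact_mod_cast hn1
  have hnc' : c ≤ n := Nat.ceil_le.mp hnc
  have hsq1 : 1 ≤ Real.sqrt n := Real.one_le_sqrt.mpr hn
  set ε := 1 / Real.sqrt n with hεd
  have hε0 : 0 ≤ ε := by positivity
  have hε1 : ε ≤ 1 := by rw [hεd, div_le_one (by linarith)]; exact hsq1
  have hε2 : ε ^ 2 = 1 / n := by rw [hεd, div_pow, one_pow, Real.sq_sqrt (by linarith)]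
  have hnε : (n : ℝ) * ε ^ 2 = 1 := by rw [hε2]; field_simp
  have he : ∀ i j, ‖Complex.exp (Complex.I * ((ε * d i j : ℝ) : ℂ))‖ ≤ 1 := by
    intro i j; rw [mul_comm, Complex.norm_exp_ofReal_mul_I]
  have hll : ‖((1 - ε ^ 2 * c / 2 : ℝ) : ℂ)‖ ≤ 1 := by
    rw [Complex.norm_real, Real.norm_eq_abs, abs_le]
    have h0 : 0 ≤ ε ^ 2 * c := by positivity
    have h1 : ε ^ 2 * c ≤ 1 := by
      rw [← hnε, mul_comm]; gcongr
    constructor <;> linarith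
  have hst := one_step hK hK1 hm hv hg hc hD hG hε0 hε1
  have h1 := tiltOp_iter_approx hK hK1 he hll hst n i hi
  have h2 := tiltOp_iter_diff (f := fun _ => 1) (h := fun j => 1 + ((ε ^ 2 * g j : ℝ) : ℂ)) hK hK1 he
    (B := ε ^ 2 * Gb) (by
      intro i hi
      rw [sub_add_cancel_left, norm_neg, Complex.norm_real, Real.norm_eq_abs, abs_mul, abs_of_nonneg (by positivity)]
      gcongr; exact hG i hi) n i hi
  have hlam : (1 + ((-c / 2 : ℝ) : ℂ) / n) = ((1 - ε ^ 2 * c / 2 : ℝ) : ℂ) := by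
    rw [hε2]; push_cast; ring
  rw [hlam, dist_comm, dist_eq_norm]
  set l := ((1 - ε ^ 2 * c / 2 : ℝ) : ℂ)
  have h3 : ‖l ^ n * ((ε ^ 2 * g i : ℝ) : ℂ)‖ ≤ ε ^ 2 * Gb := by
    have h4 : ‖((ε ^ 2 * g i : ℝ) : ℂ)‖ = ε ^ 2 * |g i| := by
      rw [Complex.norm_real, Real.norm_eq_abs, abs_mul, abs_of_nonneg (a := ε ^ 2) (by positivity)]
    rw [norm_mul, norm_pow, h4]
    calc _ ≤ 1 * (ε ^ 2 * |g i|) := by gcongr; exact pow_le_one₀ (norm_nonneg _) hll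
      _ ≤ _ := by rw [one_mul]; gcongr; exact hG i hi
  have key : ∀ a b x y : ℂ, a - x = (a - b) + (b - x * (1 + y)) + x * y := by intros; ring
  rw [key _ _ _ ((ε ^ 2 * g i : ℝ) : ℂ)]
  refine (norm_add_le _ _).trans ((add_le_add ((norm_add_le _ _).trans (add_le_add h2 h1)) h3).trans (le_of_eq ?_))
  linear_combination (ε * C) * hnε


lemma poisson_fin {ι : Type} [Fintype ι] [Nonempty ι] (K : ι → ι → ℝ) (π : ι → ℝ)
    (hK : ∀ i j, 0 < K i j) (hK1 : ∀ i, ∑ j, K i j = 1)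
    (hπ1 : ∑ i, π i = 1) (hst : ∀ j, ∑ i, π i * K i j = π j) (f : ι → ℝ) (hf : ∑ i, π i * f i = 0) :
    ∃ g : ι → ℝ, ∀ i, g i - ∑ j, K i j * g j = f i := by
  let L : (ι → ℝ) →ₗ[ℝ] (ι → ℝ) := LinearMap.id - Matrix.mulVecLin (Matrix.of K)
  have hL : ∀ g i, L g i = g i - ∑ j, K i j * g j := by
    intro g i; simp [L, Matrix.mulVec, dotProduct]
  let P : (ι → ℝ) →ₗ[ℝ] ℝ := ∑ i, π i • LinearMap.proj i
  have hP : ∀ g, P g = ∑ i, π i * g i := by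
    intro g; simp [P]
  have hle : LinearMap.range L ≤ LinearMap.ker P := by
    rintro _ ⟨g, rfl⟩
    rw [LinearMap.mem_ker, hP]
    simp only [hL, mul_sub, Finset.sum_sub_distrib, Finset.mul_sum]
    rw [Finset.sum_comm, sub_eq_zero]
    refine Finset.sum_congr rfl fun j _ => ?_
    rw [← hst j, Finset.sum_mul]
    exact Finset.sum_congr rfl fun i _ => by ring
  have hker : LinearMap.ker L ≤ Submodule.span ℝ {fun _ => (1:ℝ)} := by
    intro g hg
    have hg' : ∀ i, g i = ∑ j, K i j * g j := fun i => by
      have := congrFun (LinearMap.mem_ker.mp hg) i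
      rw [hL] at this; simpa [sub_eq_zero] using this
    obtain ⟨m, hm⟩ := Finite.exists_max g
    rw [Submodule.mem_span_singleton]
    refine ⟨g m, ?_⟩
    have h0 : ∑ j, K m j * (g m - g j) = 0 := by
      simp only [mul_sub, Finset.sum_sub_distrib, ← Finset.sum_mul, hK1, one_mul]
      rw [← hg' m, sub_self]
    rw [Finset.sum_eq_zero_iff_of_nonneg (fun j _ => mul_nonneg (hK m j).le (sub_nonneg.mpr (hm j)))] at h0
    funext j
    have := h0 j (Finset.mem_univ j)
    rcases mul_eq_zero.mp this with h | h
    · exact absurd h (hK m j).ne'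
    · simp; linarith
  have hd1 : Module.finrank ℝ (LinearMap.ker L) ≤ 1 :=
    (Submodule.finrank_mono hker).trans (by simpa using finrank_span_le_card (R := ℝ) ({fun _ => (1:ℝ)} : Set (ι → ℝ)))
  have hd2 := LinearMap.finrank_range_add_finrank_ker L
  have hd3 := LinearMap.finrank_range_add_finrank_ker P
  have hd4 : 1 ≤ Module.finrank ℝ (LinearMap.range P) := by
    rw [LinearMap.range_eq_top.mpr]
    · simp
    · intro c
      refine ⟨fun _ => c, ?_⟩
      rw [hP, ← Finset.sum_mul, hπ1, one_mul]
  have heq := Submodule.eq_of_le_of_finrank_le hle (by omega)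
  have : f ∈ LinearMap.range L := by rw [heq, LinearMap.mem_ker, hP, hf]
  obtain ⟨g, hg⟩ := this
  exact ⟨g, fun i => by rw [← hL, hg]⟩

lemma poisson_nat (N : ℕ) (K : ℕ → ℕ → ℝ) (π : ℕ → ℝ)
    (hK : ∀ i ∈ range (N+1), ∀ j ∈ range (N+1), 0 < K i j)
    (hK1 : ∀ i ∈ range (N+1), ∑ j ∈ range (N+1), K i j = 1)
    (hπ1 : ∑ i ∈ range (N+1), π i = 1)
    (hst : ∀ j ∈ range (N+1), ∑ i ∈ range (N+1), π i * K i j = π j)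
    (f : ℕ → ℝ) (hf : ∑ i ∈ range (N+1), π i * f i = 0) :
    ∃ g : ℕ → ℝ, ∀ i ∈ range (N+1), g i - ∑ j ∈ range (N+1), K i j * g j = f i := by
  have hr : ∀ i : Fin (N+1), (i : ℕ) ∈ range (N+1) := fun i => Finset.mem_range.mpr i.2
  obtain ⟨g, hg⟩ := poisson_fin (ι := Fin (N+1)) (fun i j => K i j) (fun i => π i)
    (fun i j => hK _ (hr i) _ (hr j))
    (fun i => by rw [← hK1 i (hr i), Finset.sum_range])
    (by rw [← hπ1, Finset.sum_range])
    (fun j => by rw [← hst j (hr j), Finset.sum_range])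
    (fun i => f i) (by rw [← hf, Finset.sum_range])
  refine ⟨fun i => if h : i < N+1 then g ⟨i, h⟩ else 0, fun i hi => ?_⟩
  have hi' := Finset.mem_range.mp hi
  have := hg ⟨i, hi'⟩
  rw [Finset.sum_range]
  simp only [hi', Fin.is_lt, dite_true]
  exact this

open Polynomial in
lemma coeff_lin_pow (a b : ℝ) (n k : ℕ) :
    ((C a + C b * X : ℝ[X]) ^ n).coeff k = (n.choose k : ℝ) * b ^ k * a ^ (n - k) := by
  rw [add_comm, add_pow, finsetSum_coeff]
  have : ∀ m ∈ range (n+1), ((C b * X : ℝ[X]) ^ m * (C a) ^ (n - m) * (n.choose m : ℝ[X])).coeff k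
      = if k = m then (n.choose k : ℝ) * b ^ k * a ^ (n - k) else 0 := by
    intro m _
    have : (C b * X : ℝ[X]) ^ m * (C a) ^ (n - m) * (n.choose m : ℝ[X])
      = C ((n.choose m : ℝ) * b ^ m * a ^ (n - m)) * X ^ m := by
      simp only [map_mul, map_pow, map_natCast, mul_pow]; ring
    rw [this, coeff_C_mul_X_pow]
    split_ifs with h
    · subst h; rfl
    · rfl
  rw [Finset.sum_congr rfl this, Finset.sum_ite_eq]
  split_ifs with h
  · rfl
  · rw [Nat.choose_eq_zero_of_lt (by simpa using h)]; simp

open Polynomial in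
def genP (N : ℕ) (ρ p : ℝ) (i : ℕ) : ℝ[X] :=
  (C (1 - (p * (1 - ρ) + ρ)) + C (p * (1 - ρ) + ρ) * X) ^ i *
    (C (1 - p * (1 - ρ)) + C (p * (1 - ρ)) * X) ^ (N - i)

lemma genP_coeff (N : ℕ) (ρ p : ℝ) (i : ℕ) (hi : i ≤ N) (j : ℕ) :
    (genP N ρ p i).coeff j = barK N ρ p i j := by
  rw [genP, Polynomial.coeff_mul]
  simp only [coeff_lin_pow]
  rw [Finset.Nat.sum_antidiagonal_eq_sum_range_succ
    (fun k l => (i.choose k : ℝ) * (p * (1 - ρ) + ρ) ^ k * (1 - (p * (1 - ρ) + ρ)) ^ (i - k) *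
      (((N - i).choose l : ℝ) * (p * (1 - ρ)) ^ l * (1 - p * (1 - ρ)) ^ (N - i - l)))]
  rw [barK]
  symm
  apply Finset.sum_subset_zero_on_sdiff
  · intro k hk
    simp only [Finset.mem_Icc, Finset.mem_range] at hk ⊢
    omega
  · intro k hk
    simp only [Finset.mem_sdiff, Finset.mem_Icc, Finset.mem_range] at hk
    by_cases h : i < k
    · rw [Nat.choose_eq_zero_of_lt h]; simp
    · rw [Nat.choose_eq_zero_of_lt (n := N - i) (k := j - k) (by omega)]; simp
  · intro k hk
    simp only [Finset.mem_Icc] at hk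
    have : N + k - (i + j) = N - i - (j - k) := by omega
    rw [this]; ring

lemma barK_zero (N : ℕ) (ρ p : ℝ) (i j : ℕ) (h : N < i ∨ N < j) : barK N ρ p i j = 0 := by
  rw [barK, Finset.Icc_eq_empty (by omega), Finset.sum_empty]

open Polynomial in
lemma genP_eq (N : ℕ) (ρ p : ℝ) (i : ℕ) (hi : i ≤ N) :
    genP N ρ p i = ∑ j ∈ range (N+1), C (barK N ρ p i j) * X ^ j := by
  ext k
  rw [genP_coeff N ρ p i hi, finsetSum_coeff]
  simp only [coeff_C_mul_X_pow, Finset.sum_ite_eq, Finset.mem_range]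
  split_ifs with h
  · rfl
  · exact barK_zero N ρ p i k (by omega)

lemma pred_cast (n : ℕ) : (n : ℝ) * ((n - 1 : ℕ) : ℝ) = n * (n - 1) := by
  cases n <;> simp

lemma barK_sum (N : ℕ) (ρ p : ℝ) (i : ℕ) (hi : i ≤ N) :
    ∑ j ∈ range (N+1), barK N ρ p i j = 1 := by
  have := congrArg (Polynomial.eval 1) (genP_eq N ρ p i hi)
  simp [genP, Polynomial.eval_finsetSum] at this
  exact this.symm

lemma barK_mean (N : ℕ) (ρ p : ℝ) (i : ℕ) (hi : i ≤ N) :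
    ∑ j ∈ range (N+1), barK N ρ p i j * j = ρ * i + N * p * (1 - ρ) := by
  have := congrArg (fun q => Polynomial.eval 1 (Polynomial.derivative q)) (genP_eq N ρ p i hi)
  simp [genP, Polynomial.eval_finsetSum, Polynomial.derivative_pow, Nat.cast_sub hi] at this
  rw [← this]; ring

lemma barK_fact2 (N : ℕ) (ρ p : ℝ) (i : ℕ) (hi : i ≤ N) :
    ∑ j ∈ range (N+1), barK N ρ p i j * (j * (j - 1)) =
      i * (i - 1) * (p * (1 - ρ) + ρ) ^ 2 + 2 * i * (N - i) * (p * (1 - ρ) + ρ) * (p * (1 - ρ))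
       + (N - i) * (N - i - 1) * (p * (1 - ρ)) ^ 2 := by
  have := congrArg (fun q => Polynomial.eval 1 (Polynomial.derivative (Polynomial.derivative q))) (genP_eq N ρ p i hi)
  simp [genP, Polynomial.eval_finsetSum, Polynomial.derivative_pow] at this
  have h1 := pred_cast (N - i)
  have h2 := pred_cast i
  rw [Nat.cast_sub hi] at h1 this
  simp only [mul_assoc, pred_cast] at this ⊢
  rw [← this]
  linear_combination ((p * (1 - ρ)) ^ 2) * h1 + ((p * (1 - ρ) + ρ) ^ 2) * h2

lemma barK_var (N : ℕ) (ρ p : ℝ) (i : ℕ) (hi : i ≤ N) :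
    ∑ j ∈ range (N+1), barK N ρ p i j * ((j : ℝ) - ρ * i - N * p * (1 - ρ)) ^ 2 = sigmaSq N ρ p i := by
  have e : ∀ j : ℕ, barK N ρ p i j * ((j : ℝ) - ρ * i - N * p * (1 - ρ)) ^ 2 =
    barK N ρ p i j * (j * (j - 1)) + (1 - 2 * (ρ * i + N * p * (1 - ρ))) * (barK N ρ p i j * j)
     + (ρ * i + N * p * (1 - ρ)) ^ 2 * barK N ρ p i j := by intro j; ring
  simp only [e, Finset.sum_add_distrib, ← Finset.mul_sum]
  rw [barK_sum N ρ p i hi, barK_mean N ρ p i hi, barK_fact2 N ρ p i hi, sigmaSq]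
  ring

lemma binom_sum (N : ℕ) (p : ℝ) : ∑ i ∈ range (N+1), binomPMF N p i = 1 := by
  have := add_pow p (1 - p) N
  rw [add_sub_cancel, one_pow] at this
  rw [this]
  exact Finset.sum_congr rfl fun i _ => by rw [binomPMF]; ring

open Polynomial in
lemma barK_stat (N : ℕ) (ρ p : ℝ) (j : ℕ) :
    ∑ i ∈ range (N+1), binomPMF N p i * barK N ρ p i j = binomPMF N p j := by
  have h : ∑ i ∈ range (N+1), C (binomPMF N p i) * genP N ρ p i = (C (1 - p) + C p * X) ^ N := by
    have e : (C (1 - p) + C p * X : ℝ[X]) = C p * (C (1 - (p * (1 - ρ) + ρ)) + C (p * (1 - ρ) + ρ) * X)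
      + C (1 - p) * (C (1 - p * (1 - ρ)) + C (p * (1 - ρ)) * X) := by
      simp only [map_add, map_sub, map_mul, map_one]; ring
    rw [e, add_pow]
    refine Finset.sum_congr rfl fun i _ => ?_
    simp only [genP, binomPMF, map_mul, map_pow, map_natCast, mul_pow]
    ring
  have := congrArg (fun q => q.coeff j) h
  simp only [finsetSum_coeff, coeff_C_mul, coeff_lin_pow] at this
  rw [binomPMF, ← this]
  refine Finset.sum_congr rfl fun i hi => ?_
  rw [genP_coeff N ρ p i (by simpa [Nat.lt_succ_iff] using hi)]

lemma param_bounds {p ρ : ℝ} (hp0 : 0 < p) (hp1 : p < 1)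
    (hρl : max (-(p / (1 - p))) (-((1 - p) / p)) < ρ) (hρu : ρ < 1) :
    0 < p * (1 - ρ) ∧ 0 < 1 - p * (1 - ρ) ∧ 0 < p * (1 - ρ) + ρ ∧ 0 < 1 - (p * (1 - ρ) + ρ) := by
  obtain ⟨h1, h2⟩ := max_lt_iff.mp hρl
  have hq : 0 < 1 - p := by linarith
  rw [neg_lt, lt_div_iff₀ hq] at h1
  rw [neg_lt, lt_div_iff₀ hp0] at h2
  refine ⟨by nlinarith, by nlinarith, by nlinarith, by nlinarith⟩

lemma barK_pos {N : ℕ} {p ρ : ℝ} (hb : 0 < p * (1 - ρ) ∧ 0 < 1 - p * (1 - ρ) ∧ 0 < p * (1 - ρ) + ρ ∧ 0 < 1 - (p * (1 - ρ) + ρ))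
    (i j : ℕ) (hi : i ≤ N) (hj : j ≤ N) : 0 < barK N ρ p i j := by
  obtain ⟨h1, h2, h3, h4⟩ := hb
  rw [barK]
  apply Finset.sum_pos
  · intro k hk
    simp only [Finset.mem_Icc] at hk
    have c1 : 0 < i.choose k := Nat.choose_pos (by omega)
    have c2 : 0 < (N - i).choose (j - k) := Nat.choose_pos (by omega)
    positivity
  · rw [Finset.nonempty_Icc]; omega

lemma barK_nonneg {N : ℕ} {p ρ : ℝ} (hb : 0 < p * (1 - ρ) ∧ 0 < 1 - p * (1 - ρ) ∧ 0 < p * (1 - ρ) + ρ ∧ 0 < 1 - (p * (1 - ρ) + ρ))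
    (i j : ℕ) : 0 ≤ barK N ρ p i j := by
  obtain ⟨h1, h2, h3, h4⟩ := hb
  exact Finset.sum_nonneg fun k _ => by positivity


/-- Cylinder set. -/
def cyl (t : ℕ) (x : ℕ → ℕ) : Set (ℕ → ℕ) := {ω | ∀ s ≤ t, ω s = x s}

lemma cyl_meas (t : ℕ) (x : ℕ → ℕ) : MeasurableSet (cyl t x) := by
  have : cyl t x = ⋂ s ∈ Set.Iic t, (fun ω : ℕ → ℕ => ω s) ⁻¹' {x s} := by
    ext ω; simp [cyl]
  rw [this]
  exact MeasurableSet.biInter (Set.to_countable _) fun s _ => measurable_pi_apply s (measurableSet_singleton _)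

lemma cyl_succ (t : ℕ) (x : ℕ → ℕ) :
    cyl t x = ⋃ j : ℕ, cyl (t+1) (Function.update x (t+1) j) := by
  ext ω
  simp only [cyl, Set.mem_ofPred_eq, Set.mem_iUnion]
  constructor
  · intro h
    refine ⟨ω (t+1), fun s hs => ?_⟩
    by_cases hst : s = t + 1
    · subst hst; simp
    · rw [Function.update_of_ne hst]; exact h s (by omega)
  · rintro ⟨j, h⟩ s hs
    rw [h s (by omega), Function.update_of_ne (by omega)]

lemma cyl_disj (t : ℕ) (x : ℕ → ℕ) :
    Pairwise (Function.onFun Disjoint fun j : ℕ => cyl (t+1) (Function.update x (t+1) j)) := by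
  intro a b hab
  rw [Function.onFun, Set.disjoint_left]
  intro ω ha hb
  have h1 := ha (t+1) le_rfl
  have h2 := hb (t+1) le_rfl
  simp at h1 h2
  exact hab (h1 ▸ h2)

lemma path_meas (e : ℕ → ℕ → ℂ) (t m : ℕ) :
    Measurable fun ω : ℕ → ℕ => ∏ s ∈ range m, e (ω (t+s)) (ω (t+s+1)) := by
  apply Finset.measurable_fun_prod
  intro s _
  have : Measurable fun q : ℕ × ℕ => e q.1 q.2 := measurable_of_countable _
  have h2 : Measurable fun ω : ℕ → ℕ => (ω (t+s), ω (t+s+1)) :=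
    (measurable_pi_apply (t+s)).prodMk (measurable_pi_apply (t+s+1))
  exact this.comp h2

lemma path_int (μ : Measure (ℕ → ℕ)) [IsProbabilityMeasure μ] (e : ℕ → ℕ → ℂ)
    (he : ∀ i j, ‖e i j‖ ≤ 1) (t m : ℕ) :
    Integrable (fun ω : ℕ → ℕ => ∏ s ∈ range m, e (ω (t+s)) (ω (t+s+1))) μ := by
  refine Integrable.of_bound (path_meas e t m).aestronglyMeasurable 1 (Eventually.of_forall fun ω => ?_)
  rw [norm_prod]
  exact Finset.prod_le_one (fun _ _ => norm_nonneg _) fun _ _ => he _ _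

lemma path_cyl {N : ℕ} {K : ℕ → ℕ → ℝ} {π : ℕ → ℝ} (hK : ∀ i j, 0 ≤ K i j)
    (hK0 : ∀ i j, N < j → K i j = 0) (hπ : ∀ i, 0 ≤ π i)
    (μ : Measure (ℕ → ℕ)) [IsProbabilityMeasure μ]
    (hμ : ∀ (n : ℕ) (x : ℕ → ℕ),
      μ {ω | ∀ t ≤ n, ω t = x t} =
        ENNReal.ofReal (π (x 0) * ∏ t ∈ Finset.Icc 1 n, K (x (t - 1)) (x t)))
    (e : ℕ → ℕ → ℂ) (he : ∀ i j, ‖e i j‖ ≤ 1) (m : ℕ) : ∀ (t : ℕ) (x : ℕ → ℕ),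
    ∫ ω in cyl t x, ∏ s ∈ range m, e (ω (t+s)) (ω (t+s+1)) ∂μ =
      (μ.real (cyl t x) : ℂ) * (tiltOp N K e)^[m] (fun _ => 1) (x t) := by
  have hreal : ∀ (t : ℕ) (x : ℕ → ℕ), μ.real (cyl t x) = π (x 0) * ∏ t ∈ Finset.Icc 1 t, K (x (t - 1)) (x t) := by
    intro t x
    rw [Measure.real, cyl, hμ, ENNReal.toReal_ofReal]
    exact mul_nonneg (hπ _) (Finset.prod_nonneg fun _ _ => hK _ _)
  have hstep : ∀ (t : ℕ) (x : ℕ → ℕ) (j : ℕ),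
      μ.real (cyl (t+1) (Function.update x (t+1) j)) = μ.real (cyl t x) * K (x t) j := by
    intro t x j
    rw [hreal, hreal, Finset.prod_Icc_succ_top (by omega), mul_assoc]
    congr 1
    · rw [Function.update_of_ne (by omega)]
      congr 1
      · refine Finset.prod_congr rfl fun s hs => ?_
        simp only [Finset.mem_Icc] at hs
        rw [Function.update_of_ne (by omega), Function.update_of_ne (by omega)]
      · simp
  induction m with
  | zero => intro t x; simp
  | succ m ih =>
    intro t x
    have hS := hasSum_integral_iUnion (μ := μ)
      (f := fun ω : ℕ → ℕ => ∏ s ∈ range (m+1), e (ω (t+s)) (ω (t+s+1)))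
      (s := fun j : ℕ => cyl (t+1) (Function.update x (t+1) j))
      (fun j => cyl_meas _ _) (cyl_disj t x) (path_int μ e he t (m+1)).integrableOn
    rw [← cyl_succ] at hS
    have hterm : ∀ j : ℕ, ∫ ω in cyl (t+1) (Function.update x (t+1) j),
        ∏ s ∈ range (m+1), e (ω (t+s)) (ω (t+s+1)) ∂μ =
        (μ.real (cyl t x) : ℂ) * ((K (x t) j : ℂ) * e (x t) j * (tiltOp N K e)^[m] (fun _ => 1) j) := by
      intro j
      have h1 : ∫ ω in cyl (t+1) (Function.update x (t+1) j),
        ∏ s ∈ range (m+1), e (ω (t+s)) (ω (t+s+1)) ∂μ =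
        ∫ ω in cyl (t+1) (Function.update x (t+1) j), e (x t) j *
        ∏ s ∈ range m, e (ω (t+1+s)) (ω (t+1+s+1)) ∂μ := by
        refine setIntegral_congr_fun (cyl_meas _ _) fun ω hω => ?_
        have a1 := hω t (by omega)
        have a2 := hω (t+1) le_rfl
        rw [Function.update_of_ne (by omega)] at a1
        rw [Function.update_self] at a2
        change ∏ s ∈ range (m+1), e (ω (t+s)) (ω (t+s+1)) = e (x t) j * ∏ s ∈ range m, e (ω (t+1+s)) (ω (t+1+s+1))
        rw [Finset.prod_range_succ', mul_comm, add_zero, a1, a2]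
        congr 1
        refine Finset.prod_congr rfl fun s _ => ?_
        rw [show t + (s + 1) = t + 1 + s by ring]
      rw [h1, integral_const_mul, ih, hstep, Function.update_self]
      push_cast; ring
    simp only [hterm] at hS
    rw [Function.iterate_succ_apply']
    refine hS.unique ?_
    rw [tiltOp, Finset.mul_sum]
    apply hasSum_sum_of_ne_finset_zero
    intro j hj
    rw [hK0 _ _ (by simpa [Nat.lt_succ_iff] using hj)]; simp

lemma path_full {N : ℕ} {K : ℕ → ℕ → ℝ} {π : ℕ → ℝ} (hK : ∀ i j, 0 ≤ K i j)
    (hK0 : ∀ i j, N < j → K i j = 0) (hπ : ∀ i, 0 ≤ π i) (hπ0 : ∀ i, N < i → π i = 0)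
    (μ : Measure (ℕ → ℕ)) [IsProbabilityMeasure μ]
    (hμ : ∀ (n : ℕ) (x : ℕ → ℕ),
      μ {ω | ∀ t ≤ n, ω t = x t} =
        ENNReal.ofReal (π (x 0) * ∏ t ∈ Finset.Icc 1 n, K (x (t - 1)) (x t)))
    (e : ℕ → ℕ → ℂ) (he : ∀ i j, ‖e i j‖ ≤ 1) (m : ℕ) :
    ∫ ω, ∏ s ∈ range m, e (ω s) (ω (s+1)) ∂μ =
      ∑ i ∈ range (N+1), (π i : ℂ) * (tiltOp N K e)^[m] (fun _ => 1) i := by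
  have hU : (⋃ i : ℕ, cyl 0 (fun _ => i)) = Set.univ := by
    ext ω; simp [cyl]
  have hI := path_int μ e he 0 m
  simp only [zero_add] at hI
  have hS := hasSum_integral_iUnion (μ := μ)
      (f := fun ω : ℕ → ℕ => ∏ s ∈ range m, e (ω s) (ω (s+1)))
      (s := fun j : ℕ => cyl 0 (fun _ => j))
      (fun j => cyl_meas _ _) (by
        intro a b hab
        rw [Function.onFun, Set.disjoint_left]
        intro ω ha hb
        exact hab ((ha 0 le_rfl).symm.trans (hb 0 le_rfl))) hI.integrableOn
  rw [hU, setIntegral_univ] at hS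
  have hterm : ∀ j : ℕ, ∫ ω in cyl 0 (fun _ => j), ∏ s ∈ range m, e (ω s) (ω (s+1)) ∂μ =
      (π j : ℂ) * (tiltOp N K e)^[m] (fun _ => 1) j := by
    intro j
    have := path_cyl hK hK0 hπ μ hμ e he m 0 (fun _ => j)
    simp only [zero_add] at this
    rw [this, Measure.real, cyl, hμ, ENNReal.toReal_ofReal]
    · simp
    · exact mul_nonneg (hπ _) (Finset.prod_nonneg fun _ _ => hK _ _)
  simp only [hterm] at hS
  refine hS.unique ?_
  apply hasSum_sum_of_ne_finset_zero
  intro j hj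
  rw [hπ0 _ (by simpa [Nat.lt_succ_iff] using hj)]; simp

/-- Lévy continuity on `ℝ × ℝ`. -/
lemma levy_prod {Ω : Type} [MeasurableSpace Ω] (μ : Measure Ω) [IsProbabilityMeasure μ]
    (Z : ℕ → Ω → ℝ × ℝ) (hZ : ∀ n, Measurable (Z n))
    (G : Measure (ℝ × ℝ)) [IsProbabilityMeasure G]
    (h : ∀ u : ℝ × ℝ, Tendsto (fun n => ∫ ω, Complex.exp (Complex.I * ((u.1 * (Z n ω).1 + u.2 * (Z n ω).2 : ℝ) : ℂ)) ∂μ)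
      atTop (nhds (∫ x, Complex.exp (Complex.I * ((u.1 * x.1 + u.2 * x.2 : ℝ) : ℂ)) ∂G)))
    (f : BoundedContinuousFunction (ℝ × ℝ) ℝ) :
    Tendsto (fun n => ∫ ω, f (Z n ω) ∂μ) atTop (nhds (∫ x, f x ∂G)) := by
  have hto : Measurable (WithLp.toLp 2 : ℝ × ℝ → WithLp 2 (ℝ × ℝ)) := WithLp.measurable_toLp 2 _
  have hZ' : ∀ n, Measurable (fun ω => (WithLp.toLp 2 (Z n ω) : WithLp 2 (ℝ × ℝ))) := fun n => hto.comp (hZ n)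
  let ν : ℕ → ProbabilityMeasure (WithLp 2 (ℝ × ℝ)) := fun n =>
    ⟨μ.map (fun ω => (WithLp.toLp 2 (Z n ω) : WithLp 2 (ℝ × ℝ))), Measure.isProbabilityMeasure_map (hZ' n).aemeasurable⟩
  let ν₀ : ProbabilityMeasure (WithLp 2 (ℝ × ℝ)) :=
    ⟨G.map (WithLp.toLp 2 : ℝ × ℝ → WithLp 2 (ℝ × ℝ)), Measure.isProbabilityMeasure_map hto.aemeasurable⟩
  have hch : ∀ t : WithLp 2 (ℝ × ℝ), Measurable fun x : WithLp 2 (ℝ × ℝ) => Complex.exp ((inner ℝ x t : ℝ) * Complex.I) := by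
    intro t
    have : Continuous fun x : WithLp 2 (ℝ × ℝ) => Complex.exp ((inner ℝ x t : ℝ) * Complex.I) := by fun_prop
    exact this.measurable
  have key : Tendsto ν atTop (nhds ν₀) := by
    rw [ProbabilityMeasure.tendsto_iff_tendsto_charFun]
    intro t
    have e0 : charFun (ν₀ : Measure (WithLp 2 (ℝ × ℝ))) t = ∫ x, Complex.exp (Complex.I * ((t.fst * x.1 + t.snd * x.2 : ℝ) : ℂ)) ∂G := by
      rw [charFun_apply]
      change ∫ x, _ ∂(G.map _) = _
      rw [integral_map hto.aemeasurable (hch t).aestronglyMeasurable]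
      refine integral_congr_ae (Eventually.of_forall fun x => ?_)
      simp only [WithLp.prod_inner_apply]
      rw [mul_comm]; simp [mul_comm]
    have e1 : ∀ n, charFun (ν n : Measure (WithLp 2 (ℝ × ℝ))) t =
        ∫ ω, Complex.exp (Complex.I * ((t.fst * (Z n ω).1 + t.snd * (Z n ω).2 : ℝ) : ℂ)) ∂μ := by
      intro n
      rw [charFun_apply]
      change ∫ x, _ ∂(μ.map _) = _
      rw [integral_map (hZ' n).aemeasurable (hch t).aestronglyMeasurable]
      refine integral_congr_ae (Eventually.of_forall fun x => ?_)
      simp only [WithLp.prod_inner_apply]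
      rw [mul_comm]; simp [mul_comm]
    rw [e0]
    simp only [e1]
    exact h (t.fst, t.snd)
  rw [ProbabilityMeasure.tendsto_iff_forall_integral_tendsto] at key
  have hc : Continuous (WithLp.ofLp : WithLp 2 (ℝ × ℝ) → ℝ × ℝ) := WithLp.prod_continuous_ofLp 2 _ _
  have k := key (f.compContinuous ⟨_, hc⟩)
  have hfm : AEStronglyMeasurable (fun x : WithLp 2 (ℝ × ℝ) => f (WithLp.ofLp x)) (ν₀ : Measure (WithLp 2 (ℝ × ℝ))) :=
    (f.continuous.comp hc).aestronglyMeasurable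
  have c0 : ∫ x, (f.compContinuous ⟨_, hc⟩) x ∂(ν₀ : Measure (WithLp 2 (ℝ × ℝ))) = ∫ x, f x ∂G := by
    change ∫ x, _ ∂(G.map _) = _
    rw [integral_map hto.aemeasurable (f.compContinuous ⟨_, hc⟩).continuous.aestronglyMeasurable]
    rfl
  have c1 : ∀ n, ∫ x, (f.compContinuous ⟨_, hc⟩) x ∂(ν n : Measure (WithLp 2 (ℝ × ℝ))) = ∫ ω, f (Z n ω) ∂μ := by
    intro n
    change ∫ x, _ ∂(μ.map _) = _
    rw [integral_map (hZ' n).aemeasurable (f.compContinuous ⟨_, hc⟩).continuous.aestronglyMeasurable]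
    rfl
  rw [c0] at k
  simpa only [c1] using k

/-- **Central limit theorem for the CLS score.**
With `s_t = X_t - ρ X_{t-1} - N p (1-ρ)`, the law of
`n^{-1/2} (Σ_{t=1}^n s_t (X_{t-1} - Np), N(1-ρ) Σ_{t=1}^n s_t)` converges weakly
to the centered Gaussian on ℝ² with covariance matrix `W_CLS` (characterized by its
characteristic function). -/
theorem cls_score_clt
    (N : ℕ) (hN : 1 ≤ N) (p ρ : ℝ) (hp0 : 0 < p) (hp1 : p < 1)
    (hρl : max (-(p / (1 - p))) (-((1 - p) / p)) < ρ) (hρu : ρ < 1)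
    (μ : Measure (ℕ → ℕ)) [IsProbabilityMeasure μ]
    (hμ : ∀ (n : ℕ) (x : ℕ → ℕ),
      μ {ω | ∀ t ≤ n, ω t = x t} =
        ENNReal.ofReal (binomPMF N p (x 0) *
          ∏ t ∈ Finset.Icc 1 n, barK N ρ p (x (t - 1)) (x t)))
    (G : Measure (ℝ × ℝ)) [IsProbabilityMeasure G]
    (hG : ∀ u : ℝ × ℝ,
      ∫ x, Complex.exp (Complex.I * ((u.1 * x.1 + u.2 * x.2 : ℝ) : ℂ)) ∂G =
        Complex.exp
          (((-(![u.1, u.2] ⬝ᵥ (Wcls N ρ p).mulVec ![u.1, u.2]) / 2 : ℝ) : ℂ))) :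
    ∀ f : BoundedContinuousFunction (ℝ × ℝ) ℝ,
      Tendsto
        (fun n : ℕ => ∫ ω,
          f ((1 / Real.sqrt n) *
                ∑ t ∈ Finset.Icc 1 n,
                  (xR ω t - ρ * xR ω (t - 1) - N * p * (1 - ρ)) * (xR ω (t - 1) - N * p),
              (1 / Real.sqrt n) * (N * (1 - ρ)) *
                ∑ t ∈ Finset.Icc 1 n,
                  (xR ω t - ρ * xR ω (t - 1) - N * p * (1 - ρ))) ∂μ)
        atTop (nhds (∫ x, f x ∂G)) := by
  have hb := param_bounds hp0 hp1 hρl hρu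
  have hπ : ∀ i, 0 ≤ binomPMF N p i := fun i => by
    have : 0 < 1 - p := by linarith
    rw [binomPMF]; positivity
  have hπ0 : ∀ i, N < i → binomPMF N p i = 0 := fun i hi => by
    rw [binomPMF, Nat.choose_eq_zero_of_lt hi]; simp
  have hr : ∀ i ∈ range (N+1), i ≤ N := fun i hi => by simpa [Nat.lt_succ_iff] using hi
  refine levy_prod μ (fun n ω => ((1 / Real.sqrt n) *
                ∑ t ∈ Finset.Icc 1 n,
                  (xR ω t - ρ * xR ω (t - 1) - N * p * (1 - ρ)) * (xR ω (t - 1) - N * p),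
              (1 / Real.sqrt n) * (N * (1 - ρ)) *
                ∑ t ∈ Finset.Icc 1 n,
                  (xR ω t - ρ * xR ω (t - 1) - N * p * (1 - ρ)))) ?_ G ?_
  · intro n
    have hx : ∀ t, Measurable fun ω : ℕ → ℕ => xR ω t := fun t =>
      (measurable_of_countable (fun k : ℕ => (k : ℝ))).comp (measurable_pi_apply t)
    fun_prop
  intro u
  rw [hG u]
  set w : ℕ → ℝ := fun i => u.1 * ((i : ℝ) - N * p) + u.2 * (N * (1 - ρ)) with hw
  set d : ℕ → ℕ → ℝ := fun i j => ((j : ℝ) - ρ * i - N * p * (1 - ρ)) * w i with hd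
  set v : ℕ → ℝ := fun i => sigmaSq N ρ p i * w i ^ 2 with hvd
  set c : ℝ := ∑ i ∈ range (N+1), binomPMF N p i * v i with hcd
  have hWc : ![u.1, u.2] ⬝ᵥ (Wcls N ρ p).mulVec ![u.1, u.2] = c := by
    have e : ∀ i : ℕ, binomPMF N p i * v i =
        u.1 ^ 2 * (binomPMF N p i * ((i : ℝ) - N * p) ^ 2 * sigmaSq N ρ p i)
        + 2 * u.1 * u.2 * (N * (1 - ρ)) * (binomPMF N p i * ((i : ℝ) - N * p) * sigmaSq N ρ p i)
        + u.2 ^ 2 * ((N : ℝ) ^ 2 * (1 - ρ) ^ 2) * (binomPMF N p i * sigmaSq N ρ p i) := by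
      intro i; simp only [hvd, hw]; ring
    rw [hcd, Finset.sum_congr rfl fun i _ => e i]
    simp only [Finset.sum_add_distrib, ← Finset.mul_sum]
    simp [Wcls, Matrix.mulVec, dotProduct, Fin.sum_univ_two]
    ring
  rw [hWc]
  have hK := barK_nonneg (N := N) hb
  have hK1 : ∀ i ∈ range (N+1), ∑ j ∈ range (N+1), barK N ρ p i j = 1 :=
    fun i hi => barK_sum N ρ p i (hr i hi)
  have hm : ∀ i ∈ range (N+1), ∑ j ∈ range (N+1), barK N ρ p i j * d i j = 0 := by
    intro i hi
    have e : ∀ j : ℕ, barK N ρ p i j * d i j =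
        (barK N ρ p i j * j) * w i - barK N ρ p i j * ((ρ * i + N * p * (1 - ρ)) * w i) := by
      intro j; simp only [hd]; ring
    simp only [e, Finset.sum_sub_distrib, ← Finset.sum_mul]
    rw [hK1 i hi, barK_mean N ρ p i (hr i hi)]; ring
  have hv : ∀ i ∈ range (N+1), ∑ j ∈ range (N+1), barK N ρ p i j * d i j ^ 2 = v i := by
    intro i hi
    simp only [hd, mul_pow, ← mul_assoc, ← Finset.sum_mul]
    simp only [mul_assoc, hvd]
    rw [← barK_var N ρ p i (hr i hi)]
    simp only [mul_assoc]
  have hc : 0 ≤ c := Finset.sum_nonneg fun i hi => mul_nonneg (hπ i) (by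
    rw [← hv i hi]; exact Finset.sum_nonneg fun j _ => mul_nonneg (hK i j) (sq_nonneg _))
  obtain ⟨g, hg⟩ := poisson_nat N (barK N ρ p) (binomPMF N p)
    (fun i hi j hj => barK_pos hb i j (hr i hi) (hr j hj)) hK1 (binom_sum N p)
    (fun j _ => barK_stat N ρ p j) (fun i => - (v i - c) / 2) (by
      have e : ∀ i, binomPMF N p i * (-(v i - c) / 2) =
        (-1/2) * (binomPMF N p i * v i) + binomPMF N p i * (c / 2) := by intro i; ring
      simp only [e, Finset.sum_add_distrib, ← Finset.mul_sum, ← Finset.sum_mul]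
      rw [binom_sum, ← hcd]; ring)
  have hlim := tilt_limit hK hK1 hm hv hg hc
  have hsum := tendsto_finsetSum (range (N+1)) fun i hi => (hlim i hi).const_mul (binomPMF N p i : ℂ)
  rw [← Finset.sum_mul, ← Complex.ofReal_sum, binom_sum, Complex.ofReal_one, one_mul] at hsum
  refine hsum.congr fun n => ?_
  rw [← path_full hK (fun i j hj => barK_zero N ρ p i j (Or.inr hj)) hπ hπ0 μ hμ _ (by
    intro i j; rw [mul_comm, Complex.norm_exp_ofReal_mul_I]) n]
  refine integral_congr_ae (Eventually.of_forall fun ω => ?_)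
  simp only
  rw [← Complex.exp_sum]
  congr 1
  rw [← Finset.mul_sum, ← Complex.ofReal_sum]
  congr 2
  rw [← Finset.mul_sum]
  have hI : ∀ F : ℕ → ℝ, ∑ t ∈ Finset.Icc 1 n, F t = ∑ s ∈ range n, F (s + 1) := by
    intro F
    rw [Finset.range_eq_Ico, Finset.sum_Ico_add' F 0 n 1]
    rfl
  rw [hI, hI]
  simp only [Nat.add_sub_cancel, xR, hd, hw, mul_add, Finset.sum_add_distrib]
  simp only [Finset.mul_sum]
  rw [← Finset.sum_add_distrib, ← Finset.sum_add_distrib]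
  exact Finset.sum_congr rfl fun s _ => by ring
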